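/- Let x ∈ A be solvable with v_{ρ,σ}(x) ≥ ρ + σ for every pair (ρ,σ) of relatively prime positive integers. Suppose the edges of x are exactly E_{ρ₁,σ₁}(x), …, E_{ρ_k,σ_k}(x) with k ≥ 2, where (ρ₁,σ₁), …, (ρ_k,σ_k) are pairs of relatively prime positive integers with ρ₁/σ₁ < ρ₂/σ₂ < ⋯ < ρ_k/σ_k, and that for each l the (ρ_l,σ_l)-polynomial of x equals f_l^{r_l}, where r_l ≥ 1 and f_l ∈ F[X,Y] is not equal to κ^m for any κ ∈ F[X,Y] and any integer m > 1. Then gcd(r₁, r₂, …, r_k) > 1. (Theorem 5.6) -/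

import Mathlib

open scoped BigOperators

/-- Defining relation of the Weyl algebra: `p * q = q * p + 1`. -/
inductive WeylRel (F : Type*) [CommRing F] :
    FreeAlgebra F (Fin 2) → FreeAlgebra F (Fin 2) → Prop
  | comm : WeylRel F (FreeAlgebra.ι F 0 * FreeAlgebra.ι F 1)
      (FreeAlgebra.ι F 1 * FreeAlgebra.ι F 0 + 1)

/-- The Weyl algebra over `F`. -/
abbrev WeylAlgebra (F : Type*) [CommRing F] := RingQuot (WeylRel F)

variable (F : Type*) [Field F] [CharZero F]

/-- The generator `p` of the Weyl algebra. -/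
noncomputable def Wp : WeylAlgebra F :=
  RingQuot.mkAlgHom F (WeylRel F) (FreeAlgebra.ι F 0)

/-- The generator `q` of the Weyl algebra. -/
noncomputable def Wq : WeylAlgebra F :=
  RingQuot.mkAlgHom F (WeylRel F) (FreeAlgebra.ι F 1)

/-- `x` is solvable if `[x, y] = 1` for some `y`. -/
def Solvable (x : WeylAlgebra F) : Prop := ∃ y : WeylAlgebra F, x * y - y * x = 1

/-- The centralizer `C(x)`. -/
def Cset (x : WeylAlgebra F) : Set (WeylAlgebra F) := {y | x * y - y * x = 0}

/-- `N(x) = {y | (ad x)^n y = 0 for some n ≥ 1}`. -/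
def Nset (x : WeylAlgebra F) : Set (WeylAlgebra F) :=
  {y | ∃ n : ℕ, 1 ≤ n ∧ (fun z => x * z - z * x)^[n] y = 0}

/-- `D(x) = {y | [x,y] = λ y for some scalar λ}`. -/
def Dset (x : WeylAlgebra F) : Set (WeylAlgebra F) :=
  {y | ∃ c : F, x * y - y * x = c • y}

def Delta1 : Set (WeylAlgebra F) :=
  {x | x ∉ Set.range (algebraMap F (WeylAlgebra F)) ∧
    Nset F x = Set.univ ∧ Dset F x = Cset F x}

def Delta2 : Set (WeylAlgebra F) :=
  {x | x ∉ Set.range (algebraMap F (WeylAlgebra F)) ∧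
    Nset F x ≠ Set.univ ∧ Nset F x ≠ Cset F x ∧ Dset F x = Cset F x}

/-- The graded component `A_s = {a | [pq, a] = s • a}`. -/
def Wgrade (s : ℤ) : Set (WeylAlgebra F) :=
  {a | (Wp F * Wq F) * a - a * (Wp F * Wq F) = s • a}

/-- The monomial `p^i q^j`. -/
noncomputable def Wmono (i j : ℕ) : WeylAlgebra F := Wp F ^ i * Wq F ^ j

/-- `α` is the coordinate family of `x` in the basis `p^i q^j`. -/
def Represents (α : (ℕ × ℕ) →₀ F) (x : WeylAlgebra F) : Prop :=
  x = α.sum fun ij c => c • Wmono F ij.1 ij.2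

/-- `v_{ρ,σ}(x) = max { iρ + jσ | (i,j) ∈ E(x) }`. -/
def vdeg (α : (ℕ × ℕ) →₀ F) (ρ σ : ℕ) : ℕ :=
  α.support.sup fun ij => ij.1 * ρ + ij.2 * σ

/-- `E_{ρ,σ}(x)`. -/
def Eset (α : (ℕ × ℕ) →₀ F) (ρ σ : ℕ) : Finset (ℕ × ℕ) :=
  α.support.filter fun ij => ij.1 * ρ + ij.2 * σ = vdeg F α ρ σ

/-- The `(ρ,σ)`-polynomial of `x`, an element of `F[X,Y]`. -/
noncomputable def wpoly (α : (ℕ × ℕ) →₀ F) (ρ σ : ℕ) : MvPolynomial (Fin 2) F :=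
  ∑ ij ∈ Eset F α ρ σ,
    MvPolynomial.monomial (Finsupp.single 0 ij.1 + Finsupp.single 1 ij.2) (α ij)

/-- The `(ρ,σ)`-term of `x`, an element of the Weyl algebra. -/
noncomputable def wterm (α : (ℕ × ℕ) →₀ F) (ρ σ : ℕ) : WeylAlgebra F :=
  ∑ ij ∈ Eset F α ρ σ, α ij • Wmono F ij.1 ij.2

set_option linter.unusedSectionVars false

section Representation

open Polynomial

/-- The operator representing `p`: multiplication by `T ^ ρ`. -/
def shiftEnd (ρ : ℕ) : Module.End F (ℤ → F[X]) where
  toFun a n := a (n - ρ)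
  map_add' _ _ := rfl
  map_smul' _ _ := rfl

/-- Multiplication by `X * T ^ σ`. -/
noncomputable def mulShiftEnd (σ : ℕ) : Module.End F (ℤ → F[X]) where
  toFun a n := X * a (n - σ)
  map_add' a b := by ext1 n; simp [mul_add]
  map_smul' c a := by ext1 n; simp

/-- The derivation along `p`, in the coordinates `p = T ^ ρ`, `q = X * T ^ σ`. -/
noncomputable def derivEnd (ρ σ : ℕ) : Module.End F (ℤ → F[X]) where
  toFun a n := (ρ : F)⁻¹ • (((n + ρ : ℤ) : F) • a (n + ρ) - (σ : F) • (X * derivative (a (n + ρ))))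
  map_add' a b := by
    ext1 n
    simp only [Pi.add_apply, derivative_add, mul_add, smul_add, smul_sub]
    abel
  map_smul' c a := by
    ext1 n
    simp only [Pi.smul_apply, derivative_smul, RingHom.id_apply, mul_smul_comm, smul_sub,
      smul_smul]
    congr 2 <;> ring

lemma shiftEnd_apply (ρ : ℕ) (a : ℤ → F[X]) (n : ℤ) : shiftEnd F ρ a n = a (n - ρ) := rfl

lemma mulShiftEnd_apply (σ : ℕ) (a : ℤ → F[X]) (n : ℤ) :
    mulShiftEnd F σ a n = X * a (n - σ) := rfl

lemma derivEnd_apply (ρ σ : ℕ) (a : ℤ → F[X]) (n : ℤ) :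
    derivEnd F ρ σ a n = (ρ : F)⁻¹ • (((n + ρ : ℤ) : F) • a (n + ρ) -
      (σ : F) • (X * derivative (a (n + ρ)))) := rfl

/-- The operator representing `q`. -/
noncomputable def repQ (ρ σ : ℕ) : Module.End F (ℤ → F[X]) := mulShiftEnd F σ - derivEnd F ρ σ

lemma shiftEnd_mul_repQ {ρ : ℕ} (hρ : 0 < ρ) (σ : ℕ) :
    shiftEnd F ρ * repQ F ρ σ = repQ F ρ σ * shiftEnd F ρ + 1 := by
  have h : (ρ : F) ≠ 0 := by exact_mod_cast hρ.ne'
  refine LinearMap.ext fun a => funext fun n => ?_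
  simp only [repQ, Module.End.mul_apply, LinearMap.sub_apply, LinearMap.add_apply,
    Module.End.one_apply, Pi.sub_apply, Pi.add_apply, shiftEnd_apply, mulShiftEnd_apply,
    derivEnd_apply, sub_add_cancel, add_sub_cancel_right]
  rw [sub_right_comm]
  simp only [smul_eq_C_mul, mul_sub, Int.cast_add, Int.cast_natCast, C_add, add_mul, mul_add,
    ← mul_assoc, ← C_mul, inv_mul_cancel₀ h]
  simp only [C_1, one_mul]
  abel

lemma derivEnd_mul_mulShiftEnd (ρ σ : ℕ) :
    derivEnd F ρ σ * mulShiftEnd F σ = mulShiftEnd F σ * derivEnd F ρ σ := by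
  refine LinearMap.ext fun a => funext fun n => ?_
  simp only [Module.End.mul_apply, mulShiftEnd_apply, derivEnd_apply,
    show n - (σ : ℤ) + ρ = n + ρ - σ by ring]
  simp only [smul_eq_C_mul, derivative_mul, derivative_X, Int.cast_add, Int.cast_sub,
    Int.cast_natCast, C_add, C_sub]
  ring

/-- The representation of the Weyl algebra on Laurent series adapted to the weight `(ρ, σ)`. -/
noncomputable def weylRep {ρ : ℕ} (hρ : 0 < ρ) (σ : ℕ) :
    WeylAlgebra F →ₐ[F] Module.End F (ℤ → F[X]) :=
  RingQuot.liftAlgHom F ⟨FreeAlgebra.lift F ![shiftEnd F ρ, repQ F ρ σ], by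
    rintro _ _ ⟨⟩
    simpa using shiftEnd_mul_repQ F hρ σ⟩

lemma weylRep_Wp {ρ : ℕ} (hρ : 0 < ρ) (σ : ℕ) : weylRep F hρ σ (Wp F) = shiftEnd F ρ := by
  simp [weylRep, Wp]

lemma weylRep_Wq {ρ : ℕ} (hρ : 0 < ρ) (σ : ℕ) : weylRep F hρ σ (Wq F) = repQ F ρ σ := by
  simp [weylRep, Wq]

/-- The symbol of an element of the Weyl algebra: the coefficient of `T ^ n` collects the terms of
weight `n`. -/
noncomputable def weylSymbol {ρ : ℕ} (hρ : 0 < ρ) (σ : ℕ) : WeylAlgebra F →ₗ[F] (ℤ → F[X]) :=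
  (LinearMap.applyₗ (Pi.single 0 1)).comp (weylRep F hρ σ).toLinearMap

lemma weylSymbol_apply {ρ : ℕ} (hρ : 0 < ρ) (σ : ℕ) (z : WeylAlgebra F) :
    weylSymbol F hρ σ z = weylRep F hρ σ z (Pi.single 0 1) := rfl

lemma weylSymbol_mul {ρ : ℕ} (hρ : 0 < ρ) (σ : ℕ) (z w : WeylAlgebra F) :
    weylSymbol F hρ σ (z * w) = weylRep F hρ σ z (weylSymbol F hρ σ w) := by
  simp [weylSymbol_apply]

lemma shiftEnd_single (ρ : ℕ) (m : ℤ) (f : F[X]) :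
    shiftEnd F ρ (Pi.single m f) = Pi.single (m + ρ) f := by
  ext1 n
  simp only [shiftEnd_apply, Pi.single_apply, sub_eq_iff_eq_add]

lemma mulShiftEnd_single (σ : ℕ) (m : ℤ) (f : F[X]) :
    mulShiftEnd F σ (Pi.single m f) = Pi.single (m + σ) (X * f) := by
  ext1 n
  simp only [mulShiftEnd_apply, Pi.single_apply, sub_eq_iff_eq_add, mul_ite, mul_zero]

lemma derivEnd_single {ρ : ℕ} (hρ : 0 < ρ) (σ k l : ℕ) :
    derivEnd F ρ σ (Pi.single (k * ρ + l * σ : ℤ) (X ^ l)) =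
      Pi.single (k * ρ + l * σ - ρ : ℤ) ((k : F) • X ^ l) := by
  have h : (ρ : F) ≠ 0 := by exact_mod_cast hρ.ne'
  ext1 n
  simp only [derivEnd_apply, Pi.single_apply, ← eq_sub_iff_add_eq]
  split_ifs with hn
  · subst hn
    have hX : X * derivative (X ^ l : F[X]) = (l : F) • X ^ l := by
      rcases l with _ | l
      · simp
      · rw [derivative_X_pow, smul_eq_C_mul, pow_succ]
        simp
        ring
    rw [hX, smul_smul, ← sub_smul, smul_smul]
    congr 1
    push_cast
    field_simp
    ring
  · simp

lemma shiftEnd_pow_single (ρ i : ℕ) (m : ℤ) (f : F[X]) :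
    (shiftEnd F ρ ^ i) (Pi.single m f) = Pi.single (m + i * ρ) f := by
  induction i with
  | zero => simp
  | succ i ih =>
    rw [pow_succ', Module.End.mul_apply, ih, shiftEnd_single]
    congr 1
    push_cast
    ring

lemma mulShiftEnd_pow_single (σ j : ℕ) (m : ℤ) (f : F[X]) :
    (mulShiftEnd F σ ^ j) (Pi.single m f) = Pi.single (m + j * σ) (X ^ j * f) := by
  induction j with
  | zero => simp
  | succ j ih =>
    rw [pow_succ', Module.End.mul_apply, ih, mulShiftEnd_single, ← mul_assoc, ← pow_succ']
    congr 1
    push_cast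
    ring

lemma repQ_pow_single {ρ : ℕ} (hρ : 0 < ρ) (σ j : ℕ) :
    (repQ F ρ σ ^ j) (Pi.single 0 1) = Pi.single (j * σ : ℤ) (X ^ j) := by
  induction j with
  | zero => simp
  | succ j ih =>
    have h := derivEnd_single F hρ σ 0 j
    simp only [Nat.cast_zero, zero_mul, zero_add, zero_smul, Pi.single_zero] at h
    rw [pow_succ', Module.End.mul_apply, ih, repQ, LinearMap.sub_apply, h, sub_zero,
      mulShiftEnd_single, ← pow_succ']
    congr 1
    push_cast
    ring

lemma weylSymbol_Wmono {ρ : ℕ} (hρ : 0 < ρ) (σ i j : ℕ) :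
    weylSymbol F hρ σ (Wmono F i j) = Pi.single (i * ρ + j * σ : ℤ) (X ^ j) := by
  rw [weylSymbol_apply, Wmono, map_mul, map_pow, map_pow, weylRep_Wp, weylRep_Wq,
    Module.End.mul_apply, repQ_pow_single F hρ, shiftEnd_pow_single, add_comm]

/-- Families supported in degrees at most `n`. -/
def degLE (n : ℤ) : Submodule F (ℤ → F[X]) where
  carrier := {a | ∀ m, n < m → a m = 0}
  add_mem' ha hb m hm := by simp [ha m hm, hb m hm]
  zero_mem' _ _ := rfl
  smul_mem' c a ha m hm := by simp [ha m hm]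

variable {F}

lemma degLE_mono {m n : ℤ} (h : m ≤ n) : degLE F m ≤ degLE F n :=
  fun _ ha k hk => ha k (h.trans_lt hk)

lemma mulShiftEnd_mem {σ : ℕ} {n : ℤ} {a : ℤ → F[X]} (ha : a ∈ degLE F n) :
    mulShiftEnd F σ a ∈ degLE F (n + σ) := fun m hm => by
  rw [mulShiftEnd_apply, ha _ (by lia), mul_zero]

lemma mulShiftEnd_pow_mem {σ : ℕ} {n : ℤ} {a : ℤ → F[X]} (ha : a ∈ degLE F n) (j : ℕ) :
    (mulShiftEnd F σ ^ j) a ∈ degLE F (n + j * σ) := by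
  induction j with
  | zero => simpa using ha
  | succ j ih =>
    rw [pow_succ', Module.End.mul_apply]
    exact degLE_mono (by push_cast; linarith) (mulShiftEnd_mem ih)

lemma derivEnd_mem {ρ σ : ℕ} {n : ℤ} {a : ℤ → F[X]} (ha : a ∈ degLE F n) :
    derivEnd F ρ σ a ∈ degLE F (n - ρ) := fun m hm => by
  rw [derivEnd_apply, ha _ (by lia)]
  simp

lemma repQ_mem {ρ σ : ℕ} {n : ℤ} {a : ℤ → F[X]} (ha : a ∈ degLE F n) :
    repQ F ρ σ a ∈ degLE F (n + σ) :=
  sub_mem (mulShiftEnd_mem ha) (degLE_mono (by lia) (derivEnd_mem ha))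

lemma shiftEnd_pow_mem {ρ : ℕ} {n : ℤ} {a : ℤ → F[X]} (ha : a ∈ degLE F n) (i : ℕ) :
    (shiftEnd F ρ ^ i) a ∈ degLE F (n + i * ρ) := by
  induction i with
  | zero => simpa using ha
  | succ i ih =>
    rw [pow_succ', Module.End.mul_apply]
    exact fun m hm => ih _ (by push_cast at hm; linarith)

/-- The two leading terms of the action of `q ^ j`. -/
lemma repQ_pow_sub_mem {ρ σ : ℕ} {n : ℤ} {a : ℤ → F[X]} (ha : a ∈ degLE F n) (j : ℕ) :
    (repQ F ρ σ ^ j) a - (mulShiftEnd F σ ^ j) a +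
      (j : F) • (mulShiftEnd F σ ^ (j - 1)) (derivEnd F ρ σ a) ∈
        degLE F (n + j * σ - 2 * (ρ + σ)) := by
  induction j with
  | zero => simp
  | succ j ih =>
    set S := mulShiftEnd F σ
    set D := derivEnd F ρ σ
    have hDS : ∀ k b, D ((S ^ k) b) = (S ^ k) (D b) := fun k b => by
      have : Commute D (S ^ k) := Commute.pow_right (derivEnd_mul_mulShiftEnd F ρ σ) k
      exact LinearMap.congr_fun this.eq b
    have hj : (j : F) • S ((S ^ (j - 1)) (D a)) = (j : F) • (S ^ j) (D a) := by
      rcases j with _ | j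
      · simp
      · rw [Nat.add_sub_cancel, pow_succ', Module.End.mul_apply]
    have h1 := repQ_mem (ρ := ρ) (σ := σ) ih
    have h2 : (j : F) • (S ^ (j - 1)) (D (D a)) ∈
        degLE F (n + (j + 1 : ℕ) * σ - 2 * (ρ + σ)) := by
      rcases j with _ | j
      · simp
      · refine Submodule.smul_mem _ _ (degLE_mono ?_
          (mulShiftEnd_pow_mem (derivEnd_mem (derivEnd_mem ha)) _))
        rw [Nat.add_sub_cancel]
        push_cast
        linarith
    have h3 := add_mem (degLE_mono (by push_cast; linarith) h1) h2
    convert h3 using 1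
    rw [repQ, map_add, map_sub, map_smul]
    simp only [LinearMap.sub_apply, smul_sub]
    rw [hDS, hDS, hj, pow_succ', pow_succ', Module.End.mul_apply, Module.End.mul_apply,
      Nat.add_sub_cancel, LinearMap.sub_apply]
    push_cast
    rw [add_smul, one_smul]
    abel

/-- The two leading terms of a product of two monomials. -/
lemma weylSymbol_mul_apply {ρ : ℕ} (hρ : 0 < ρ) (σ i j k l : ℕ) {n : ℤ}
    (hn : (i * ρ + j * σ : ℤ) + (k * ρ + l * σ) - 2 * (ρ + σ) < n) :
    weylSymbol F hρ σ (Wmono F i j * Wmono F k l) n =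
      (Pi.single ((i * ρ + j * σ : ℤ) + (k * ρ + l * σ)) (X ^ (j + l)) : ℤ → F[X]) n -
      (Pi.single ((i * ρ + j * σ : ℤ) + (k * ρ + l * σ) - (ρ + σ))
        ((j * k : F) • X ^ (j + l - 1)) : ℤ → F[X]) n := by
  have hb : (Pi.single (k * ρ + l * σ : ℤ) (X ^ l) : ℤ → F[X]) ∈ degLE F (k * ρ + l * σ) :=
    fun m hm => Pi.single_eq_of_ne hm.ne' _
  have h := shiftEnd_pow_mem (ρ := ρ) (repQ_pow_sub_mem (ρ := ρ) (σ := σ) hb j) i n (by linarith)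
  rw [derivEnd_single F hρ, mulShiftEnd_pow_single, mulShiftEnd_pow_single, map_add, map_sub,
    map_smul, shiftEnd_pow_single, shiftEnd_pow_single, Pi.add_apply, Pi.sub_apply,
    add_eq_zero_iff_eq_neg, sub_eq_iff_eq_add] at h
  rw [weylSymbol_mul, weylSymbol_Wmono, Wmono, map_mul, map_pow, map_pow, weylRep_Wp, weylRep_Wq,
    Module.End.mul_apply, h, neg_add_eq_sub, ← pow_add,
    show (k * ρ + l * σ : ℤ) + j * σ + i * ρ = i * ρ + j * σ + (k * ρ + l * σ) by ring]
  congr 1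
  rcases j with _ | j
  · simp
  · rw [show (k * ρ + l * σ - ρ + (j + 1 - 1 : ℕ) * σ + i * ρ : ℤ) =
      i * ρ + (j + 1 : ℕ) * σ + (k * ρ + l * σ) - (ρ + σ) by push_cast; ring,
      show j + 1 + l - 1 = j + l by lia]
    simp only [Pi.smul_apply, Pi.single_apply, smul_ite, smul_zero, Nat.add_sub_cancel,
      mul_smul_comm, smul_smul, pow_add]

end Representation

section Filtration

open Polynomial

/-- The weighted degree filtration of the Weyl algebra. -/
def weylFilt (ρ σ : ℕ) (d : ℤ) : Submodule F (WeylAlgebra F) :=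
  Submodule.span F {z | ∃ i j : ℕ, (i * ρ + j * σ : ℤ) ≤ d ∧ Wmono F i j = z}

/-- The Poisson bracket of weighted homogeneous polynomials of degrees `d` and `e`, up to a factor
and after dehomogenization. -/
noncomputable def homBracket {K : Type*} [CommRing K] (d e : ℤ) (f g : K[X]) : K[X] :=
  d * (f * derivative g) - e * (derivative f * g)

variable {F}

lemma weylSymbol_commutator_Wmono {ρ : ℕ} (hρ : 0 < ρ) {σ : ℕ} (hσ : 0 < σ) {i j k l : ℕ}
    {d e n : ℤ} (hd : (i * ρ + j * σ : ℤ) ≤ d) (he : (k * ρ + l * σ : ℤ) ≤ e)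
    (hn : d + e - (ρ + σ) ≤ n) :
    (ρ : F[X]) * weylSymbol F hρ σ (Wmono F i j * Wmono F k l - Wmono F k l * Wmono F i j) n =
      if n = d + e - (ρ + σ) then homBracket d e (weylSymbol F hρ σ (Wmono F i j) d)
        (weylSymbol F hρ σ (Wmono F k l) e) else 0 := by
  rw [map_sub, Pi.sub_apply, weylSymbol_mul_apply hρ σ i j k l (by lia),
    weylSymbol_mul_apply hρ σ k l i j (by lia), weylSymbol_Wmono, weylSymbol_Wmono,
    add_comm (k * ρ + l * σ : ℤ), add_comm l j, sub_sub_sub_cancel_left, ← Pi.sub_apply,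
    ← Pi.single_sub, ← sub_smul, Pi.single_apply, Pi.single_apply, Pi.single_apply]
  by_cases hd' : d = i * ρ + j * σ
  · by_cases he' : e = k * ρ + l * σ
    · subst hd' he'
      simp only [if_true]
      split_ifs
      · rw [homBracket, smul_eq_C_mul]
        rcases j with _ | j <;> rcases l with _ | l
        · simp
        · simp
          ring
        · simp
          ring
        · rw [show j + 1 + (l + 1) - 1 = j + l + 1 by lia]
          simp
          ring
      · simp
    · rw [if_neg (by lia), if_neg he']
      simp [homBracket]
  · rw [if_neg (by lia), if_neg hd']
    simp [homBracket]

/-- The leading term of a commutator is given by the Poisson bracket. -/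
lemma weylSymbol_commutator {ρ : ℕ} (hρ : 0 < ρ) {σ : ℕ} (hσ : 0 < σ) {d e n : ℤ}
    (hn : d + e - (ρ + σ) ≤ n) {z w : WeylAlgebra F} (hz : z ∈ weylFilt F ρ σ d)
    (hw : w ∈ weylFilt F ρ σ e) :
    (ρ : F[X]) * weylSymbol F hρ σ (z * w - w * z) n =
      if n = d + e - (ρ + σ) then homBracket d e (weylSymbol F hρ σ z d)
        (weylSymbol F hρ σ w e) else 0 := by
  induction hz, hw using Submodule.span_induction₂ with
  | mem_mem z w hz hw =>
    obtain ⟨i, j, hij, rfl⟩ := hz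
    obtain ⟨k, l, hkl, rfl⟩ := hw
    exact weylSymbol_commutator_Wmono hρ hσ hij hkl hn
  | zero_left w hw => simp [homBracket]
  | zero_right z hz => simp [homBracket]
  | add_left z z' w _ _ _ h h' =>
    rw [show (z + z') * w - w * (z + z') = (z * w - w * z) + (z' * w - w * z') by noncomm_ring,
      map_add, Pi.add_apply, mul_add, h, h']
    split_ifs
    · simp only [homBracket, map_add, Pi.add_apply]
      ring
    · simp
  | add_right z w w' _ _ _ h h' =>
    rw [show z * (w + w') - (w + w') * z = (z * w - w * z) + (z * w' - w' * z) by noncomm_ring,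
      map_add, Pi.add_apply, mul_add, h, h']
    split_ifs
    · simp only [homBracket, map_add, Pi.add_apply]
      ring
    · simp
  | smul_left c z w _ _ h =>
    rw [smul_mul_assoc, mul_smul_comm, ← smul_sub, map_smul, Pi.smul_apply, mul_smul_comm, h]
    split_ifs
    · simp only [homBracket, map_smul, Pi.smul_apply]
      simp only [smul_eq_C_mul]
      ring
    · simp
  | smul_right c z w _ _ h =>
    rw [smul_mul_assoc, mul_smul_comm, ← smul_sub, map_smul, Pi.smul_apply, mul_smul_comm, h]
    split_ifs
    · simp only [homBracket, map_smul, Pi.smul_apply]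
      simp only [smul_eq_C_mul]
      ring
    · simp

lemma Wp_mul_Wq : Wp F * Wq F = Wq F * Wp F + 1 := by
  simpa [Wp, Wq] using RingQuot.mkAlgHom_rel F (WeylRel.comm (F := F))

lemma Wq_mul_Wp_pow (i : ℕ) : Wq F * Wp F ^ i = Wp F ^ i * Wq F - (i : F) • Wp F ^ (i - 1) := by
  induction i with
  | zero => simp
  | succ i ih =>
    have h : (i : F) • (Wp F ^ (i - 1) * Wp F) = (i : F) • Wp F ^ i := by
      rcases i with _ | i
      · simp
      · rw [Nat.add_sub_cancel, ← pow_succ]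
    rw [pow_succ, ← mul_assoc, ih, sub_mul, mul_assoc, smul_mul_assoc, h, mul_assoc, Wp_mul_Wq,
      mul_add, mul_one, Nat.add_sub_cancel]
    push_cast
    rw [add_smul, one_smul]
    abel

lemma Wq_mul_Wmono (i j : ℕ) :
    Wq F * Wmono F i j = Wmono F i (j + 1) - (i : F) • Wmono F (i - 1) j := by
  rw [Wmono, ← mul_assoc, Wq_mul_Wp_pow, sub_mul, mul_assoc, ← pow_succ', smul_mul_assoc]
  rfl

lemma exists_represents (z : WeylAlgebra F) : ∃ α, Represents F α z := by
  suffices h : z ∈ Submodule.span F (Set.range fun ij : ℕ × ℕ => Wmono F ij.1 ij.2) by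
    obtain ⟨α, hα⟩ := Finsupp.mem_span_range_iff_exists_finsupp.1 h
    exact ⟨α, hα.symm⟩
  set S := Submodule.span F (Set.range fun ij : ℕ × ℕ => Wmono F ij.1 ij.2)
  have hS : ∀ i j, Wmono F i j ∈ S := fun i j => Submodule.subset_span ⟨(i, j), rfl⟩
  obtain ⟨a, rfl⟩ := RingQuot.mkAlgHom_surjective F (WeylRel F) z
  suffices h : ∀ w ∈ S, RingQuot.mkAlgHom F (WeylRel F) a * w ∈ S by
    simpa using h 1 (by simpa [Wmono] using hS 0 0)
  induction a using FreeAlgebra.induction with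
  | grade0 r =>
    intro w hw
    rw [AlgHom.commutes, ← Algebra.smul_def]
    exact S.smul_mem r hw
  | grade1 i =>
    intro w hw
    induction hw using Submodule.span_induction with
    | mem w hw =>
      obtain ⟨⟨k, l⟩, rfl⟩ := hw
      fin_cases i
      · have : Wp F * Wmono F k l = Wmono F (k + 1) l := by
          rw [Wmono, Wmono, ← mul_assoc, ← pow_succ']
        exact this ▸ hS _ _
      · exact Wq_mul_Wmono (F := F) k l ▸ sub_mem (hS _ _) (S.smul_mem _ (hS _ _))
    | zero => simp
    | add u v _ _ hu hv =>
      rw [mul_add]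
      exact add_mem hu hv
    | smul c u _ hu =>
      rw [mul_smul_comm]
      exact S.smul_mem c hu
  | mul a b ha hb =>
    intro w hw
    rw [map_mul, mul_assoc]
    exact ha _ (hb _ hw)
  | add a b ha hb =>
    intro w hw
    rw [map_add, add_mul]
    exact add_mem (ha _ hw) (hb _ hw)

lemma Represents.weylSymbol_coeff {ρ : ℕ} (hρ : 0 < ρ) {σ : ℕ} {z : WeylAlgebra F}
    {α : (ℕ × ℕ) →₀ F} (h : Represents F α z) (n : ℤ) (j : ℕ) :
    (weylSymbol F hρ σ z n).coeff j =
      α.sum fun ij c => if n = ij.1 * ρ + ij.2 * σ ∧ j = ij.2 then c else 0 := by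
  rw [h, map_finsuppSum, Finsupp.sum, Finset.sum_apply, finsetSum_coeff, Finsupp.sum]
  refine Finset.sum_congr rfl fun ij _ => ?_
  rw [map_smul, weylSymbol_Wmono, Pi.smul_apply, coeff_smul, Pi.single_apply]
  split_ifs <;> simp_all [coeff_X_pow]

lemma Represents.weylSymbol_coeff_weight {ρ : ℕ} (hρ : 0 < ρ) {σ : ℕ} {z : WeylAlgebra F}
    {α : (ℕ × ℕ) →₀ F} (h : Represents F α z) (i j : ℕ) :
    (weylSymbol F hρ σ z (i * ρ + j * σ)).coeff j = α (i, j) := by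
  rw [h.weylSymbol_coeff, Finsupp.sum, Finset.sum_eq_single (i, j)]
  · simp
  · rintro ⟨a, b⟩ _ hab
    refine if_neg ?_
    rintro ⟨h1, h2⟩
    obtain rfl : j = b := h2
    refine hab (Prod.ext ?_ rfl)
    have : (i : ℤ) * ρ = a * ρ := by simpa using h1
    exact_mod_cast (mul_right_cancel₀ (by exact_mod_cast hρ.ne') this).symm
  · intro h
    simp [Finsupp.notMem_support_iff.1 h]

lemma Represents.exists_of_weylSymbol_coeff_ne_zero {ρ : ℕ} (hρ : 0 < ρ) {σ : ℕ}
    {z : WeylAlgebra F} {α : (ℕ × ℕ) →₀ F} (h : Represents F α z) {n : ℤ} {j : ℕ}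
    (hj : (weylSymbol F hρ σ z n).coeff j ≠ 0) :
    ∃ i : ℕ, n = i * ρ + j * σ ∧ (i, j) ∈ α.support := by
  rw [h.weylSymbol_coeff] at hj
  obtain ⟨⟨a, b⟩, hab, hne⟩ := Finset.exists_ne_zero_of_sum_ne_zero hj
  simp only [ne_eq, ite_eq_right_iff, Classical.not_imp] at hne
  obtain ⟨⟨h1, rfl⟩, -⟩ := hne
  exact ⟨a, h1, hab⟩

lemma Represents.mem_weylFilt {ρ σ : ℕ} {z : WeylAlgebra F} {α : (ℕ × ℕ) →₀ F}
    (h : Represents F α z) {d : ℤ} (hd : ∀ ij ∈ α.support, (ij.1 * ρ + ij.2 * σ : ℤ) ≤ d) :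
    z ∈ weylFilt F ρ σ d := by
  rw [h]
  exact sum_mem fun ij hij =>
    Submodule.smul_mem _ _ (Submodule.subset_span ⟨_, _, hd ij hij, rfl⟩)

lemma mem_weylFilt_of_weylSymbol {ρ : ℕ} (hρ : 0 < ρ) {σ : ℕ} {z : WeylAlgebra F} {d : ℤ}
    (h : ∀ n, d < n → weylSymbol F hρ σ z n = 0) : z ∈ weylFilt F ρ σ d := by
  obtain ⟨α, hα⟩ := exists_represents z
  refine hα.mem_weylFilt fun ij hij => not_lt.1 fun hlt => ?_
  have := hα.weylSymbol_coeff_weight hρ (σ := σ) ij.1 ij.2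
  rw [h _ hlt, coeff_zero] at this
  exact Finsupp.mem_support_iff.1 hij this.symm

lemma weylSymbol_mem_degLE {ρ : ℕ} (hρ : 0 < ρ) {σ : ℕ} {z : WeylAlgebra F} {d : ℤ}
    (hz : z ∈ weylFilt F ρ σ d) : weylSymbol F hρ σ z ∈ degLE F d := by
  suffices h : weylFilt F ρ σ d ≤ (degLE F d).comap (weylSymbol F hρ σ) from h hz
  refine Submodule.span_le.2 ?_
  rintro _ ⟨i, j, hij, rfl⟩ n hn
  rw [weylSymbol_Wmono, Pi.single_eq_of_ne (by lia)]

/-- Every nonzero element of the Weyl algebra has an exact degree. -/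
lemma exists_leading {ρ : ℕ} (hρ : 0 < ρ) {σ : ℕ} {z : WeylAlgebra F} (hz : z ≠ 0) :
    ∃ e : ℕ, z ∈ weylFilt F ρ σ e ∧ weylSymbol F hρ σ z e ≠ 0 := by
  obtain ⟨α, hα⟩ := exists_represents z
  have hne : α.support.Nonempty := by
    refine Finsupp.support_nonempty_iff.2 fun h => hz ?_
    rw [hα, h, Finsupp.sum_zero_index]
  obtain ⟨⟨i, j⟩, hij, hmax⟩ := α.support.exists_max_image (fun ij => ij.1 * ρ + ij.2 * σ) hne
  refine ⟨i * ρ + j * σ, hα.mem_weylFilt fun ab hab => by exact_mod_cast hmax ab hab,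
    fun h0 => ?_⟩
  have := hα.weylSymbol_coeff_weight hρ (σ := σ) i j
  push_cast at h0
  rw [h0, coeff_zero] at this
  exact Finsupp.mem_support_iff.1 hij this.symm

end Filtration

section OneVariable

open Polynomial

variable {K : Type*} [Field K]

lemma X_mul_homBracket_natDegree_le (d e : ℤ) (f g : K[X]) :
    (X * homBracket d e f g).natDegree ≤ f.natDegree + g.natDegree ∧
      (X * homBracket d e f g).coeff (f.natDegree + g.natDegree) =
        ((d * g.natDegree - e * f.natDegree : ℤ) : K) * (f.leadingCoeff * g.leadingCoeff) := by
  have key : ∀ p : K[X], (X * derivative p).natDegree ≤ p.natDegree ∧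
      (X * derivative p).coeff p.natDegree = p.natDegree * p.leadingCoeff := fun p => by
    constructor
    · rcases Nat.eq_zero_or_pos p.natDegree with h | h
      · rw [derivative_of_natDegree_zero h]
        simp
      · refine natDegree_mul_le.trans ?_
        have := natDegree_derivative_lt h.ne'
        have := natDegree_X_le (R := K)
        lia
    · rcases h : p.natDegree with _ | n
      · simp
      · rw [coeff_X_mul, coeff_derivative, leadingCoeff, h]
        push_cast
        ring
  have hX : X * homBracket d e f g = (d : K[X]) * (f * (X * derivative g)) -
      (e : K[X]) * (X * derivative f * g) := by
    rw [homBracket]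
    ring
  have hcast : ∀ (c : ℤ) (p : K[X]), (c : K[X]) * p = (c : K) • p := fun c p => by
    rw [smul_eq_C_mul, ← map_intCast (C : K →+* K[X])]
  rw [hX, hcast, hcast]
  constructor
  · refine (natDegree_sub_le _ _).trans (max_le ?_ ?_)
    · exact (natDegree_smul_le _ _).trans (natDegree_mul_le_of_le le_rfl (key g).1)
    · exact (natDegree_smul_le _ _).trans (natDegree_mul_le_of_le (key f).1 le_rfl)
  · rw [coeff_sub, coeff_smul, coeff_smul, coeff_mul_add_eq_of_natDegree_le le_rfl (key g).1,
      coeff_mul_add_eq_of_natDegree_le (key f).1 le_rfl, (key g).2, (key f).2,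
      coeff_natDegree, coeff_natDegree]
    push_cast
    simp only [smul_eq_mul]
    ring

lemma homBracket_natDegree [CharZero K] {d e : ℤ} {f g : K[X]} (hf : f ≠ 0) (hg : g ≠ 0)
    (h : d * g.natDegree ≠ e * f.natDegree) :
    homBracket d e f g ≠ 0 ∧ (homBracket d e f g).natDegree + 1 = f.natDegree + g.natDegree := by
  obtain ⟨h1, h2⟩ := X_mul_homBracket_natDegree_le d e f g
  have h3 : (X * homBracket d e f g).coeff (f.natDegree + g.natDegree) ≠ 0 := by
    rw [h2]
    exact mul_ne_zero (by exact_mod_cast sub_ne_zero.2 h)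
      (mul_ne_zero (leadingCoeff_ne_zero.2 hf) (leadingCoeff_ne_zero.2 hg))
  have h4 : homBracket d e f g ≠ 0 := fun h0 => h3 (by simp [h0])
  refine ⟨h4, ?_⟩
  rw [← natDegree_X_mul h4]
  exact le_antisymm h1 (le_natDegree_of_ne_zero h3)

lemma exists_X_sub_C_mul_homBracket (d e : ℤ) {f g : K[X]} (hf : f ≠ 0) (hg : g ≠ 0) (a : K) :
    ∃ u v : K[X], ¬ (X - C a) ∣ u ∧ (X - C a) * homBracket d e f g =
      (X - C a) ^ (f.rootMultiplicity a + g.rootMultiplicity a) *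
        (((d * g.rootMultiplicity a - e * f.rootMultiplicity a : ℤ) : K[X]) * u + (X - C a) * v) := by
  obtain ⟨f₀, hf₀, hf₁⟩ := exists_eq_pow_rootMultiplicity_mul_and_not_dvd f hf a
  obtain ⟨g₀, hg₀, hg₁⟩ := exists_eq_pow_rootMultiplicity_mul_and_not_dvd g hg a
  refine ⟨f₀ * g₀, homBracket d e f₀ g₀, fun h => ?_, ?_⟩
  · exact ((prime_X_sub_C a).dvd_or_dvd h).elim hf₁ hg₁
  have key : ∀ (n : ℕ) (p : K[X]), (X - C a) * derivative ((X - C a) ^ n * p) =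
      (X - C a) ^ n * ((n : K[X]) * p + (X - C a) * derivative p) := fun n p => by
    rcases n with _ | n
    · simp
    · rw [derivative_mul, derivative_X_sub_C_pow, Nat.add_sub_cancel, map_natCast]
      ring
  set m := f.rootMultiplicity a
  set n := g.rootMultiplicity a
  calc (X - C a) * homBracket d e f g
      = (d : K[X]) * (f * ((X - C a) * derivative g)) - (e : K[X]) * ((X - C a) * derivative f * g) := by
        rw [homBracket]
        ring
    _ = _ := by
        rw [hf₀, hg₀, key, key, homBracket]
        push_cast
        ring

lemma homBracket_rootMultiplicity_ge {d e : ℤ} {f g : K[X]} (hf : f ≠ 0) (hg : g ≠ 0)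
    (h : homBracket d e f g ≠ 0) (a : K)
    (heq : d * g.rootMultiplicity a = e * f.rootMultiplicity a) :
    f.rootMultiplicity a + g.rootMultiplicity a ≤ (homBracket d e f g).rootMultiplicity a := by
  obtain ⟨u, v, -, huv⟩ := exists_X_sub_C_mul_homBracket d e hf hg a
  rw [heq, sub_self, Int.cast_zero, zero_mul, zero_add, mul_left_comm] at huv
  rw [le_rootMultiplicity_iff h, mul_left_cancel₀ (X_sub_C_ne_zero a) huv]
  exact dvd_mul_right _ _

lemma homBracket_rootMultiplicity [CharZero K] {d e : ℤ} {f g : K[X]} (hf : f ≠ 0) (hg : g ≠ 0)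
    (a : K) (hne : d * g.rootMultiplicity a ≠ e * f.rootMultiplicity a) :
    homBracket d e f g ≠ 0 ∧ (homBracket d e f g).rootMultiplicity a + 1 =
      f.rootMultiplicity a + g.rootMultiplicity a := by
  obtain ⟨u, v, hu, huv⟩ := exists_X_sub_C_mul_homBracket d e hf hg a
  generalize homBracket d e f g = b at *
  obtain ⟨c, hc⟩ : ∃ c : ℤ, d * g.rootMultiplicity a - e * f.rootMultiplicity a = c := ⟨_, rfl⟩
  have hcK : (c : K) ≠ 0 := by
    rw [← hc]
    exact_mod_cast sub_ne_zero.2 hne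
  rw [hc] at huv
  obtain ⟨r, hr⟩ : ∃ r : K[X], (c : K[X]) * u + (X - C a) * v = r := ⟨_, rfl⟩
  have hdvd : ¬ (X - C a) ∣ r := by
    have hunit : IsUnit (c : K[X]) := by
      rw [← map_intCast (C : K →+* K[X])]
      exact isUnit_C.2 (isUnit_iff_ne_zero.2 hcK)
    rwa [← hr, dvd_add_left (dvd_mul_right _ _), hunit.dvd_mul_left]
  rw [hr] at huv
  have hprod := mul_ne_zero (pow_ne_zero (f.rootMultiplicity a + g.rootMultiplicity a)
    (X_sub_C_ne_zero a)) (fun h0 : r = 0 => hdvd (h0 ▸ dvd_zero _))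
  have h0 : (X - C a) * b ≠ 0 := by rwa [huv]
  refine ⟨right_ne_zero_of_mul h0, ?_⟩
  have := congrArg (rootMultiplicity a) huv
  rwa [rootMultiplicity_mul h0, rootMultiplicity_mul hprod, rootMultiplicity_X_sub_C_self,
    rootMultiplicity_X_sub_C_pow, rootMultiplicity_eq_zero (fun h => hdvd (dvd_iff_isRoot.2 h)),
    add_zero, add_comm 1] at this

lemma sum_rootMultiplicity_le (g : K[X]) (s : Finset K) :
    ∑ a ∈ s, g.rootMultiplicity a ≤ g.natDegree := by
  classical
  refine le_trans ?_ (card_roots' g)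
  rw [← Multiset.sum_count_eq_card (s := s ∪ g.roots.toFinset) (m := g.roots) (by simp +contextual)]
  simp only [← count_roots]
  exact Finset.sum_le_sum_of_subset Finset.subset_union_left

/-- If a bracket with `f` is nonzero and commutes with `f`, then `f` has few distinct roots. -/
lemma card_roots_mul_le [IsAlgClosed K] [CharZero K] [DecidableEq K] {d e w : ℤ} (hd : 0 < d)
    (hw : 0 < w) {f g : K[X]} (h0 : homBracket d e f g ≠ 0)
    (h1 : homBracket d (d + e - w) f (homBracket d e f g) = 0) (hs : 2 ≤ f.roots.toFinset.card) :
    f.roots.toFinset.card * d ≤ w * f.natDegree := by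
  have hf : f ≠ 0 := fun h => h0 (by simp [h, homBracket])
  have hg : g ≠ 0 := fun h => h0 (by simp [h, homBracket])
  have hdeg : d * (homBracket d e f g).natDegree = (d + e - w) * f.natDegree :=
    not_not.1 fun h => (homBracket_natDegree hf h0 h).1 h1
  have hloc : ∀ a ∈ f.roots.toFinset,
      d * (g.rootMultiplicity a : ℤ) = (e - w) * f.rootMultiplicity a + d := fun a ha => by
    have hm : (0 : ℤ) < f.rootMultiplicity a := by
      exact_mod_cast (rootMultiplicity_pos hf).2 (isRoot_of_mem_roots (Multiset.mem_toFinset.1 ha))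
    have hμ : d * (homBracket d e f g).rootMultiplicity a =
        (d + e - w) * f.rootMultiplicity a :=
      not_not.1 fun h => (homBracket_rootMultiplicity hf h0 a h).1 h1
    by_cases heq : d * (g.rootMultiplicity a : ℤ) = e * f.rootMultiplicity a
    · have hge : (f.rootMultiplicity a + g.rootMultiplicity a : ℤ) ≤
          (homBracket d e f g).rootMultiplicity a := by
        exact_mod_cast homBracket_rootMultiplicity_ge hf hg h0 a heq
      nlinarith [mul_le_mul_of_nonneg_left hge hd.le, mul_pos hw hm]
    · have hq : ((homBracket d e f g).rootMultiplicity a + 1 : ℤ) =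
          f.rootMultiplicity a + g.rootMultiplicity a := by
        exact_mod_cast (homBracket_rootMultiplicity hf hg a heq).2
      linear_combination hμ - d * hq
  have hsumf : ∑ a ∈ f.roots.toFinset, (f.rootMultiplicity a : ℤ) = f.natDegree := by
    rw [(IsAlgClosed.splits f).natDegree_eq_card_roots, ← Multiset.toFinset_sum_count_eq]
    simp [count_roots]
  have hsumg : ∑ a ∈ f.roots.toFinset, (g.rootMultiplicity a : ℤ) ≤ g.natDegree := by
    exact_mod_cast sum_rootMultiplicity_le g _
  have hsum : d * ∑ a ∈ f.roots.toFinset, (g.rootMultiplicity a : ℤ) =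
      (e - w) * f.natDegree + f.roots.toFinset.card * d := by
    rw [Finset.mul_sum, Finset.sum_congr rfl hloc, Finset.sum_add_distrib, ← Finset.mul_sum, hsumf]
    simp
  have hle := mul_le_mul_of_nonneg_left hsumg hd.le
  by_cases heq : d * (g.natDegree : ℤ) = e * f.natDegree
  · linarith
  · have hq : ((homBracket d e f g).natDegree + 1 : ℤ) = f.natDegree + g.natDegree := by
      exact_mod_cast (homBracket_natDegree hf hg heq).2
    have h2 : d * (g.natDegree : ℤ) = (e - w) * f.natDegree + d := by
      linear_combination hdeg - d * hq
    have hs' : (2 : ℤ) ≤ f.roots.toFinset.card := by exact_mod_cast hs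
    nlinarith [mul_le_mul_of_nonneg_right hs' hd.le]

/-- A polynomial vanishing at `0`, not a monomial, whose exponents are congruent modulo `ρ`, has
more than `ρ` roots. -/
lemma lt_card_roots [IsAlgClosed K] [CharZero K] [DecidableEq K] {f : K[X]} {ρ j₀ j₁ : ℕ}
    (hρ : 0 < ρ) (hmod : ∀ j, f.coeff j ≠ 0 → j ≡ j₀ [MOD ρ]) (hzero : f.coeff 0 = 0)
    (h₀ : f.coeff j₀ ≠ 0) (h₁ : f.coeff j₁ ≠ 0) (hne : j₀ ≠ j₁) :
    ρ < f.roots.toFinset.card := by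
  have hf : f ≠ 0 := fun h => h₀ (by simp [h])
  obtain ⟨a, ha, ha0⟩ : ∃ a ∈ f.roots, a ≠ 0 := by
    by_contra! hall
    have hX : f = C f.leadingCoeff * X ^ Multiset.card f.roots := by
      conv_lhs => rw [(IsAlgClosed.splits f).eq_prod_roots, Multiset.eq_replicate_card.2 hall]
      simp
    have hcoeff : ∀ j, f.coeff j ≠ 0 → j = Multiset.card f.roots := fun j hj => by
      rw [hX, coeff_C_mul, coeff_X_pow] at hj
      by_contra h
      simp [h] at hj
    exact hne ((hcoeff _ h₀).trans (hcoeff _ h₁).symm)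
  have : NeZero ρ := ⟨hρ.ne'⟩
  obtain ⟨ζ, hζ⟩ := HasEnoughRootsOfUnity.exists_primitiveRoot K ρ
  have hev : ∀ t, f.eval (ζ ^ t * a) = 0 := fun t => by
    have : f.eval (ζ ^ t * a) = ζ ^ (t * j₀) * f.eval a := by
      rw [eval_eq_sum, eval_eq_sum, sum_def, sum_def, Finset.mul_sum]
      refine Finset.sum_congr rfl fun j hj => ?_
      have : ζ ^ (t * j) = ζ ^ (t * j₀) := by
        rw [mul_comm, mul_comm t, pow_mul, pow_mul, pow_eq_pow_of_modEq
          (hmod j (mem_support_iff.1 hj)) hζ.pow_eq_one]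
      rw [mul_pow, ← pow_mul, this]
      ring
    rw [this, (isRoot_of_mem_roots ha).eq_zero, mul_zero]
  have hinj : Set.InjOn (fun t => ζ ^ t * a) (Finset.range ρ) := fun s hs t ht hst =>
    hζ.pow_inj (Finset.mem_range.1 hs) (Finset.mem_range.1 ht) (mul_right_cancel₀ ha0 hst)
  have hsub : insert 0 ((Finset.range ρ).image fun t => ζ ^ t * a) ⊆ f.roots.toFinset := by
    intro b hb
    rw [Multiset.mem_toFinset, mem_roots hf, IsRoot.def]
    rcases Finset.mem_insert.1 hb with rfl | hb
    · rwa [← coeff_zero_eq_eval_zero]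
    · obtain ⟨t, -, rfl⟩ := Finset.mem_image.1 hb
      exact hev t
  have hcard := Finset.card_le_card hsub
  rwa [Finset.card_insert_of_notMem, Finset.card_image_of_injOn hinj, Finset.card_range] at hcard
  simp [ha0, hζ.ne_zero hρ.ne']

end OneVariable

section Subalgebra

open Polynomial

lemma mul_pow_of_commutator {A : Type*} [Ring A] {x y : A} (h : x * y - y * x = 1) (l : ℕ) :
    x * y ^ l - y ^ l * x = (l : A) * y ^ (l - 1) := by
  induction l with
  | zero => simp
  | succ l ih =>
    have hl : (l : A) * y ^ (l - 1) * y = (l : A) * y ^ l := by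
      rcases l with _ | l
      · simp
      · rw [Nat.add_sub_cancel, mul_assoc, ← pow_succ]
    calc x * y ^ (l + 1) - y ^ (l + 1) * x
        = (x * y ^ l - y ^ l * x) * y + y ^ l * (x * y - y * x) := by
          rw [pow_succ]
          noncomm_ring
      _ = _ := by
          rw [ih, h, hl, Nat.add_sub_cancel]
          push_cast
          noncomm_ring

lemma mul_neg_sub_neg_mul {A : Type*} [Ring A] (x y : A) : x * -y - -y * x = y * x - x * y := by
  rw [mul_neg, neg_mul]
  abel

lemma pow_mul_of_commutator {A : Type*} [Ring A] {x y : A} (h : x * y - y * x = 1) (l : ℕ) :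
    x ^ l * y - y * x ^ l = (l : A) * x ^ (l - 1) := by
  have h' : -y * x - x * -y = 1 := by
    rw [← h, ← neg_sub, mul_neg_sub_neg_mul, neg_sub]
  rw [← mul_pow_of_commutator h', ← neg_sub, ← mul_neg_sub_neg_mul, neg_sub]

lemma eq_zero_of_derivative_stable {R A : Type*} [CommRing R] [IsAddTorsionFree R]
    [AddCommMonoid A] (E : R[X] → A) (hD : ∀ P, E P = 0 → E (derivative P) = 0)
    (hC : ∀ a, E (C a) = 0 → a = 0) (P : R[X]) (hP : E P = 0) : P = 0 := by
  induction hn : P.natDegree using Nat.strong_induction_on generalizing P with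
  | _ n ih =>
    have h0 : P.natDegree = 0 := by
      by_contra hne
      exact hne (derivative_eq_zero.1 (ih _ (hn ▸ natDegree_derivative_lt hne) _ (hD P hP) rfl))
    rw [eq_C_of_natDegree_eq_zero h0] at hP ⊢
    rw [hC _ hP, C_0]

variable {F}

/-- The evaluation of ordered polynomials at a pair of elements of the Weyl algebra. -/
noncomputable def evalPair (x y : WeylAlgebra F) (P : F[X][X]) : WeylAlgebra F :=
  P.eval₂ (aeval x : F[X] →ₐ[F] WeylAlgebra F).toRingHom y

lemma evalPair_add (x y : WeylAlgebra F) (P Q : F[X][X]) :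
    evalPair x y (P + Q) = evalPair x y P + evalPair x y Q := eval₂_add _ _

lemma evalPair_monomial (x y : WeylAlgebra F) (l : ℕ) (a : F[X]) :
    evalPair x y (monomial l a) = aeval x a * y ^ l := eval₂_monomial _ _

lemma commutator_evalPair {x y : WeylAlgebra F} (h : x * y - y * x = 1) (P : F[X][X]) :
    x * evalPair x y P - evalPair x y P * x = evalPair x y (derivative P) := by
  induction P using Polynomial.induction_on' with
  | add P Q hP hQ =>
    rw [derivative_add, evalPair_add, evalPair_add, ← hP, ← hQ]
    noncomm_ring
  | monomial l a =>
    have hc : x * aeval x a = aeval x a * x := by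
      have := congrArg (aeval x) (mul_comm (X : F[X]) a)
      simpa using this
    rw [derivative_monomial, evalPair_monomial, evalPair_monomial, ← mul_assoc, hc, mul_assoc,
      mul_assoc, ← mul_sub, mul_pow_of_commutator h, ← mul_assoc, map_mul, map_natCast]

instance : Nontrivial (WeylAlgebra F) := by
  refine ⟨⟨1, 0, fun h => ?_⟩⟩
  have := weylSymbol_Wmono F one_pos 1 0 0
  rw [Wmono, pow_zero, pow_zero, one_mul, h, map_zero] at this
  simpa using congrFun this 0

lemma aeval_eq_zero {x y : WeylAlgebra F} (h : x * y - y * x = 1) (a : F[X])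
    (ha : aeval x a = 0) : a = 0 := by
  refine eq_zero_of_derivative_stable (fun a => aeval x a) (fun P hP => ?_) (fun c hc => ?_) a ha
  · have key : ∀ P : F[X], aeval x P * y - y * aeval x P = aeval x (derivative P) := fun P => by
      induction P using Polynomial.induction_on' with
      | add P Q hP hQ =>
        rw [derivative_add, map_add, map_add, ← hP, ← hQ]
        noncomm_ring
      | monomial n c =>
        rw [derivative_monomial, aeval_monomial, aeval_monomial, map_mul, map_natCast, mul_assoc,
          mul_assoc, ← pow_mul_of_commutator h, mul_sub, ← mul_assoc y, ← Algebra.commutes c y, mul_assoc]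
    rw [← key, hP]
    simp
  · simpa using hc

lemma evalPair_eq_zero {x y : WeylAlgebra F} (h : x * y - y * x = 1) (P : F[X][X])
    (hP : evalPair x y P = 0) : P = 0 := by
  refine eq_zero_of_derivative_stable (evalPair x y) (fun P hP => ?_) (fun a ha => ?_) P hP
  · rw [← commutator_evalPair h, hP]
    simp
  · rw [← monomial_zero_left, evalPair_monomial, pow_zero, mul_one] at ha
    exact aeval_eq_zero h a ha

lemma weylFilt_mono {ρ σ : ℕ} {d e : ℤ} (h : d ≤ e) : weylFilt F ρ σ d ≤ weylFilt F ρ σ e :=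
  Submodule.span_mono fun _ ⟨i, j, hij, hz⟩ => ⟨i, j, hij.trans h, hz⟩

lemma weylFilt_mul {ρ : ℕ} (hρ : 0 < ρ) {σ : ℕ} {d e : ℤ} {z w : WeylAlgebra F}
    (hz : z ∈ weylFilt F ρ σ d) (hw : w ∈ weylFilt F ρ σ e) : z * w ∈ weylFilt F ρ σ (d + e) := by
  induction hz, hw using Submodule.span_induction₂ with
  | mem_mem z w hz hw =>
    obtain ⟨i, j, hij, rfl⟩ := hz
    obtain ⟨k, l, hkl, rfl⟩ := hw
    refine mem_weylFilt_of_weylSymbol hρ (σ := σ) fun n hn => ?_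
    rw [weylSymbol_mul_apply hρ σ i j k l (by lia), Pi.single_eq_of_ne (by lia),
      Pi.single_eq_of_ne (by lia), sub_zero]
  | zero_left w hw => simp
  | zero_right z hz => simp
  | add_left z z' w _ _ _ h h' =>
    rw [add_mul]
    exact add_mem h h'
  | add_right z w w' _ _ _ h h' =>
    rw [mul_add]
    exact add_mem h h'
  | smul_left c z w _ _ h =>
    rw [smul_mul_assoc]
    exact Submodule.smul_mem _ c h
  | smul_right c z w _ _ h =>
    rw [mul_smul_comm]
    exact Submodule.smul_mem _ c h

lemma weylFilt_pow {ρ : ℕ} (hρ : 0 < ρ) {σ : ℕ} {d : ℤ} {z : WeylAlgebra F}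
    (hz : z ∈ weylFilt F ρ σ d) (k : ℕ) : z ^ k ∈ weylFilt F ρ σ (k * d) := by
  induction k with
  | zero =>
    exact Submodule.subset_span ⟨0, 0, by simp, by simp [Wmono]⟩
  | succ k ih =>
    rw [pow_succ]
    exact weylFilt_mono (by push_cast; linarith) (weylFilt_mul hρ ih hz)

/-- By counting dimensions, some polynomial in `x` and `y` has a leading term which does not
Poisson commute with the leading term of `x`. -/
lemma exists_homBracket_ne_zero {ρ : ℕ} (hρ : 0 < ρ) {σ : ℕ} {x y : WeylAlgebra F}
    (h : x * y - y * x = 1) {d : ℕ} (hd : 0 < d) (hx : x ∈ weylFilt F ρ σ d)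
    (hf : weylSymbol F hρ σ x d ≠ 0) :
    ∃ (P : F[X][X]) (e : ℤ), evalPair x y P ∈ weylFilt F ρ σ e ∧
      homBracket d e (weylSymbol F hρ σ x d) (weylSymbol F hρ σ (evalPair x y P) e) ≠ 0 := by
  by_contra! hcomm
  have hy0 : y ≠ 0 := by
    rintro rfl
    simp at h
  obtain ⟨d', hy, -⟩ := exists_leading hρ (σ := σ) hy0
  set f := weylSymbol F hρ σ x d
  set M := d + d' + 1 with hM
  set D := M * (d + d') with hD
  let v : Fin M × Fin M → WeylAlgebra F := fun kl => x ^ (kl.1 : ℕ) * y ^ (kl.2 : ℕ)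
  let φ : WeylAlgebra F →ₗ[F] (Fin (D + 1) → F) := LinearMap.pi fun e =>
    (lcoeff F ((e : ℕ) * f.natDegree / d)).comp
      ((LinearMap.proj ((e : ℕ) : ℤ)).comp (weylSymbol F hρ σ))
  have hker : (φ.comp (Fintype.linearCombination F v)).ker ≠ ⊥ := by
    refine LinearMap.ker_ne_bot_of_finrank_lt ?_
    simp only [Module.finrank_fintype_fun_eq_card, Fintype.card_prod, Fintype.card_fin]
    rw [hD, hM]
    nlinarith
  obtain ⟨c, hc, hc0⟩ := Submodule.exists_mem_ne_zero_of_ne_bot hker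
  set z := Fintype.linearCombination F v c with hz
  let P : F[X][X] := ∑ kl : Fin M × Fin M, monomial (kl.2 : ℕ) (monomial (kl.1 : ℕ) (c kl))
  have hP : evalPair x y P = z := by
    have hsum : evalPair x y P = ∑ kl : Fin M × Fin M,
        evalPair x y (monomial (kl.2 : ℕ) (monomial (kl.1 : ℕ) (c kl))) :=
      eval₂_finsetSum _ _ _ _
    rw [hsum, hz, Fintype.linearCombination_apply]
    refine Finset.sum_congr rfl fun kl _ => ?_
    rw [evalPair_monomial, aeval_monomial, Algebra.smul_def, mul_assoc]
  have hz0 : z ≠ 0 := fun h0 => hc0 <| by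
    have hP0 := evalPair_eq_zero h P (hP.trans h0)
    ext ⟨k, l⟩
    have := congrArg (fun Q : F[X][X] => (Q.coeff l).coeff k) hP0
    simp only [P, finsetSum_coeff, coeff_monomial] at this
    rw [Finset.sum_eq_single (k, l)] at this
    · simpa using this
    · rintro ⟨k', l'⟩ _ hne
      dsimp only
      split_ifs with hl
      · rw [coeff_monomial, if_neg]
        intro hk
        exact hne (Prod.ext (Fin.ext hk) (Fin.ext hl))
      · simp
    · simp
  have hzD : z ∈ weylFilt F ρ σ D := by
    rw [hz, Fintype.linearCombination_apply]
    refine sum_mem fun kl _ => Submodule.smul_mem _ _ ?_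
    refine weylFilt_mono ?_ (weylFilt_mul hρ (weylFilt_pow hρ hx kl.1) (weylFilt_pow hρ hy kl.2))
    rw [hD]
    have h1 := Nat.mul_le_mul_right d kl.1.2.le
    have h2 := Nat.mul_le_mul_right d' kl.2.2.le
    exact_mod_cast (by linarith : (kl.1 : ℕ) * d + kl.2 * d' ≤ M * (d + d'))
  obtain ⟨e, hze, hge⟩ := exists_leading hρ (σ := σ) hz0
  have heD : e ≤ D := by
    by_contra hlt
    exact hge (weylSymbol_mem_degLE hρ hzD _ (by exact_mod_cast not_le.1 hlt))
  have hbr := hcomm P e (hP ▸ hze)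
  rw [hP] at hbr
  have hdeg : (d : ℤ) * (weylSymbol F hρ σ z e).natDegree = e * f.natDegree :=
    not_not.1 fun hne => (homBracket_natDegree hf hge hne).1 hbr
  have hdeg' : e * f.natDegree / d = (weylSymbol F hρ σ z e).natDegree :=
    Nat.div_eq_of_eq_mul_right hd (by exact_mod_cast hdeg.symm)
  have hφ : (weylSymbol F hρ σ z e).coeff (e * f.natDegree / d) = 0 :=
    congrFun (LinearMap.mem_ker.1 hc) ⟨e, by lia⟩
  rw [hdeg', coeff_natDegree, leadingCoeff_eq_zero] at hφ
  exact hge hφ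

/-- The leading term `f` of a solvable element has a nonzero bracket commuting with `f`. -/
lemma exists_homBracket_homBracket {ρ : ℕ} (hρ : 0 < ρ) {σ : ℕ} (hσ : 0 < σ) {x : WeylAlgebra F}
    (h : Solvable F x) {d : ℕ} (hd : 0 < d) (hx : x ∈ weylFilt F ρ σ d)
    (hf : weylSymbol F hρ σ x d ≠ 0) :
    ∃ (e : ℤ) (g : F[X]), homBracket d e (weylSymbol F hρ σ x d) g ≠ 0 ∧
      homBracket d (d + e - (ρ + σ)) (weylSymbol F hρ σ x d)
        (homBracket d e (weylSymbol F hρ σ x d) g) = 0 := by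
  obtain ⟨y, hxy⟩ := h
  obtain ⟨P₀, hP₀⟩ := exists_homBracket_ne_zero hρ hxy hd hx hf
  set f := weylSymbol F hρ σ x d
  let Bad : F[X][X] → Prop := fun P => ∃ e : ℤ, evalPair x y P ∈ weylFilt F ρ σ e ∧
    homBracket d e f (weylSymbol F hρ σ (evalPair x y P) e) ≠ 0
  obtain ⟨P, ⟨e, hPe, hbr⟩, hP'⟩ : ∃ P, Bad P ∧ ¬ Bad (derivative P) := by
    by_contra! hall
    have hiter : ∀ n, Bad (derivative^[n] P₀) := fun n => by
      induction n with
      | zero => exact hP₀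
      | succ n ih =>
        rw [Function.iterate_succ_apply']
        exact hall _ ih
    obtain ⟨e, -, he⟩ := hiter (P₀.natDegree + 1)
    rw [iterate_derivative_eq_zero (Nat.lt_succ_self _)] at he
    exact he (by simp [evalPair, homBracket])
  refine ⟨e, _, hbr, ?_⟩
  have hlead : ∀ n : ℤ, d + e - (ρ + σ) ≤ n → (ρ : F[X]) *
      weylSymbol F hρ σ (evalPair x y (derivative P)) n = if n = d + e - (ρ + σ) then
        homBracket d e f (weylSymbol F hρ σ (evalPair x y P) e) else 0 := fun n hn => by
    rw [← commutator_evalPair hxy, weylSymbol_commutator hρ hσ hn hx hPe]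
  have hρ0 : (ρ : F[X]) ≠ 0 := by exact_mod_cast hρ.ne'
  have hmem : evalPair x y (derivative P) ∈ weylFilt F ρ σ (d + e - (ρ + σ)) :=
    mem_weylFilt_of_weylSymbol hρ fun n hn => by
      have := hlead n hn.le
      rw [if_neg hn.ne'] at this
      exact (mul_eq_zero.1 this).resolve_left hρ0
  have hz : homBracket d (d + e - (ρ + σ)) f
      (weylSymbol F hρ σ (evalPair x y (derivative P)) (d + e - (ρ + σ))) = 0 :=
    not_not.1 fun hne => hP' ⟨_, hmem, hne⟩
  have hl := hlead _ le_rfl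
  rw [if_pos rfl] at hl
  rw [← hl]
  have hmul : ∀ g : F[X], homBracket d (d + e - (ρ + σ)) f ((ρ : F[X]) * g) =
      (ρ : F[X]) * homBracket d (d + e - (ρ + σ)) f g := fun g => by
    simp only [homBracket, derivative_mul, derivative_natCast]
    ring
  rw [hmul, hz, mul_zero]

lemma homBracket_map {K L : Type*} [Field K] [Field L] (φ : K →+* L) (d e : ℤ) (f g : K[X]) :
    (homBracket d e f g).map φ = homBracket d e (f.map φ) (g.map φ) := by
  simp [homBracket, derivative_map]

/-- If an edge of a solvable element does not reach the axis `j = 0`, then `σ = 1`. -/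
lemma Solvable.snd_weight_le_one {x : WeylAlgebra F} {α : (ℕ × ℕ) →₀ F} (hrep : Represents F α x)
    (hsol : Solvable F x) {ρ σ : ℕ} (hρ : 0 < ρ) (hσ : 0 < σ) (hcop : Nat.Coprime ρ σ) {d : ℕ}
    (hmax : ∀ ij ∈ α.support, ij.1 * ρ + ij.2 * σ ≤ d) {u v : ℕ × ℕ} (hu : u ∈ α.support)
    (hv : v ∈ α.support) (huv : u ≠ v) (hud : u.1 * ρ + u.2 * σ = d)
    (hvd : v.1 * ρ + v.2 * σ = d)
    (hpos : ∀ ij ∈ α.support, ij.1 * ρ + ij.2 * σ = d → 0 < ij.2) : σ ≤ 1 := by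
  classical
  set f := weylSymbol F hρ σ x d with hf
  have hcoeff : ∀ w ∈ α.support, w.1 * ρ + w.2 * σ = d → f.coeff w.2 ≠ 0 := fun w hw hwd => by
    have := hrep.weylSymbol_coeff_weight hρ (σ := σ) w.1 w.2
    rw [hf, ← hwd]
    push_cast
    rw [this]
    exact Finsupp.mem_support_iff.1 hw
  have hline : ∀ j, f.coeff j ≠ 0 → ∃ i, i * ρ + j * σ = d ∧ (i, j) ∈ α.support := fun j hj => by
    obtain ⟨i, hi, hmem⟩ := hrep.exists_of_weylSymbol_coeff_ne_zero hρ hj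
    exact ⟨i, by exact_mod_cast hi.symm, hmem⟩
  have hu2 := hcoeff u hu hud
  have hf0 : f ≠ 0 := fun h0 => hu2 (by simp [h0])
  have hne : u.2 ≠ v.2 := fun h2 => huv <| Prod.ext (by
    have : u.1 * ρ = v.1 * ρ := by
      rw [h2] at hud
      lia
    exact Nat.eq_of_mul_eq_mul_right hρ this) h2
  have hmod : ∀ j, f.coeff j ≠ 0 → j ≡ u.2 [MOD ρ] := fun j hj => by
    obtain ⟨i, hi, -⟩ := hline j hj
    refine Nat.ModEq.cancel_right_of_coprime hcop ?_
    have h1 : i * ρ + j * σ ≡ j * σ [MOD ρ] := by simp [Nat.ModEq]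
    have h2 : u.1 * ρ + u.2 * σ ≡ u.2 * σ [MOD ρ] := by simp [Nat.ModEq]
    rw [hi] at h1
    rw [hud] at h2
    exact h1.symm.trans h2
  have hzero : f.coeff 0 = 0 := by
    by_contra h0
    obtain ⟨i, hi, hmem⟩ := hline 0 h0
    exact lt_irrefl _ (hpos _ hmem hi)
  have hd : 0 < d := by
    have := Nat.mul_pos (hpos u hu hud) hσ
    lia
  have hx : x ∈ weylFilt F ρ σ d := hrep.mem_weylFilt fun ij hij => by exact_mod_cast hmax ij hij
  obtain ⟨e, g, h0, h1⟩ := exists_homBracket_homBracket hρ hσ hsol hd hx hf0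
  let φ := algebraMap F (AlgebraicClosure F)
  have hcard : ρ < (f.map φ).roots.toFinset.card := by
    refine lt_card_roots (j₀ := u.2) (j₁ := v.2) hρ (fun j hj => hmod j fun h => ?_) ?_ ?_ ?_ hne
    · simp [h] at hj
    · simp [hzero]
    · simpa using hu2
    · simpa using hcoeff v hv hvd
  have h0' : homBracket d e (f.map φ) (g.map φ) ≠ 0 := by
    rw [← homBracket_map]
    exact (Polynomial.map_ne_zero_iff φ.injective).2 h0
  have h1' : homBracket d (d + e - (ρ + σ)) (f.map φ)
      (homBracket d e (f.map φ) (g.map φ)) = 0 := by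
    rw [← homBracket_map, ← homBracket_map, h1, Polynomial.map_zero]
  have hle := card_roots_mul_le (by exact_mod_cast hd) (by positivity) h0' h1' (by lia)
  rw [natDegree_map] at hle
  obtain ⟨i, hi, -⟩ := hline f.natDegree (by simpa using hf0)
  have hN : 0 < f.natDegree := by
    refine Nat.pos_of_ne_zero fun h => ?_
    have : f.coeff f.natDegree ≠ 0 := by simpa using hf0
    exact this (h ▸ hzero)
  have hle' : (f.map φ).roots.toFinset.card * d ≤ (ρ + σ) * f.natDegree := by exact_mod_cast hle
  have h3 : (ρ + 1) * (f.natDegree * σ) ≤ (ρ + σ) * f.natDegree :=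
    (Nat.mul_le_mul hcard (by lia)).trans hle'
  have h4 : (ρ + 1) * σ ≤ ρ + σ := by
    refine Nat.le_of_mul_le_mul_right ?_ hN
    linarith
  have h5 : ρ * σ ≤ ρ * 1 := by linarith
  exact Nat.le_of_mul_le_mul_left h5 hρ

end Subalgebra

section Swap

open MulOpposite

variable {F}

/-- The anti-automorphism of the Weyl algebra exchanging `p` and `q`. -/
noncomputable def weylSwap : WeylAlgebra F →ₐ[F] (WeylAlgebra F)ᵐᵒᵖ :=
  RingQuot.liftAlgHom F ⟨FreeAlgebra.lift F ![op (Wq F), op (Wp F)], by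
    rintro _ _ ⟨⟩
    simp only [map_mul, map_add, map_one, FreeAlgebra.lift_ι_apply, Matrix.cons_val_zero,
      Matrix.cons_val_one, ← op_mul, ← op_one, ← op_add]
    rw [Wp_mul_Wq]⟩

lemma weylSwap_Wmono (i j : ℕ) : weylSwap (Wmono F i j) = op (Wmono F j i) := by
  have hp : weylSwap (Wp F) = op (Wq F) := by simp [weylSwap, Wp]
  have hq : weylSwap (Wq F) = op (Wp F) := by simp [weylSwap, Wq]
  rw [Wmono, map_mul, map_pow, map_pow, hp, hq, ← op_pow, ← op_pow, ← op_mul, Wmono]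

lemma Represents.swap {α : (ℕ × ℕ) →₀ F} {x : WeylAlgebra F} (h : Represents F α x) :
    Represents F (α.equivMapDomain (Equiv.prodComm ℕ ℕ)) (weylSwap x).unop := by
  rw [Represents, Finsupp.sum_equivMapDomain, h, map_finsuppSum, Finsupp.sum, Finsupp.sum,
    Finset.unop_sum]
  refine Finset.sum_congr rfl fun ij _ => ?_
  rw [map_smul, weylSwap_Wmono, unop_smul, unop_op]
  rfl

lemma Solvable.swap {x : WeylAlgebra F} (h : Solvable F x) : Solvable F (weylSwap x).unop := by
  obtain ⟨y, hy⟩ := h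
  refine ⟨-(weylSwap y).unop, ?_⟩
  have := congrArg (fun z => (weylSwap z).unop) hy
  simp only [map_sub, map_mul, map_one, unop_sub, unop_mul, unop_one] at this
  exact (mul_neg_sub_neg_mul _ _).trans this

/-- If an edge of a solvable element does not reach the axis `i = 0`, then `ρ = 1`. -/
lemma Solvable.fst_weight_le_one {x : WeylAlgebra F} {α : (ℕ × ℕ) →₀ F} (hrep : Represents F α x)
    (hsol : Solvable F x) {ρ σ : ℕ} (hρ : 0 < ρ) (hσ : 0 < σ) (hcop : Nat.Coprime ρ σ) {d : ℕ}
    (hmax : ∀ ij ∈ α.support, ij.1 * ρ + ij.2 * σ ≤ d) {u v : ℕ × ℕ} (hu : u ∈ α.support)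
    (hv : v ∈ α.support) (huv : u ≠ v) (hud : u.1 * ρ + u.2 * σ = d)
    (hvd : v.1 * ρ + v.2 * σ = d)
    (hpos : ∀ ij ∈ α.support, ij.1 * ρ + ij.2 * σ = d → 0 < ij.1) : ρ ≤ 1 := by
  have hmem : ∀ ij, ij ∈ (α.equivMapDomain (Equiv.prodComm ℕ ℕ)).support ↔
      ij.swap ∈ α.support := fun ij => by
    simp [Finsupp.mem_support_iff, Finsupp.equivMapDomain_apply]
  refine Solvable.snd_weight_le_one hrep.swap hsol.swap hσ hρ hcop.symm (d := d) (u := u.swap)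
    (v := v.swap) (fun ij hij => ?_) ((hmem _).2 hu) ((hmem _).2 hv)
    (Prod.swap_injective.ne huv) ?_ ?_ fun ij hij h => ?_
  · rw [add_comm]
    exact hmax _ ((hmem _).1 hij)
  · rw [add_comm]
    exact hud
  · rw [add_comm]
    exact hvd
  · exact hpos _ ((hmem _).1 hij) (by rw [add_comm]; exact h)

end Swap

lemma mem_Eset {F : Type*} [Field F] {α : (ℕ × ℕ) →₀ F} {ρ σ : ℕ} {ij : ℕ × ℕ} :
    ij ∈ Eset F α ρ σ ↔ ij ∈ α.support ∧ ij.1 * ρ + ij.2 * σ = vdeg F α ρ σ := by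
  rw [Eset, Finset.mem_filter]

lemma weight_le_vdeg {F : Type*} [Field F] {α : (ℕ × ℕ) →₀ F} (ρ σ : ℕ) {ij : ℕ × ℕ}
    (h : ij ∈ α.support) : ij.1 * ρ + ij.2 * σ ≤ vdeg F α ρ σ :=
  Finset.le_sup (f := fun ij : ℕ × ℕ => ij.1 * ρ + ij.2 * σ) h

/-- Of two edges, the one with smaller slope `ρ / σ` does not reach the axis `j = 0`. -/
lemma snd_pos_of_edge {F : Type*} [Field F] {α : (ℕ × ℕ) →₀ F} {ρ σ ρ' σ' : ℕ}
    (hρ' : 0 < ρ') (h : ρ * σ' < ρ' * σ) (he : 1 < (Eset F α ρ' σ').card)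
    (ij : ℕ × ℕ) (hij : ij ∈ α.support) (hd : ij.1 * ρ + ij.2 * σ = vdeg F α ρ σ) : 0 < ij.2 := by
  obtain ⟨i, j⟩ := ij
  refine Nat.pos_of_ne_zero fun (hj : j = 0) => ?_
  subst hj
  obtain ⟨w, hw, hb⟩ : ∃ w ∈ Eset F α ρ' σ', 0 < w.2 := by
    by_contra! hzero
    obtain ⟨u, hu, v, hv, huv⟩ := Finset.one_lt_card.1 he
    have hu2 : u.2 = 0 := Nat.le_zero.1 (hzero u hu)
    have hv2 : v.2 = 0 := Nat.le_zero.1 (hzero v hv)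
    refine huv (Prod.ext (Nat.eq_of_mul_eq_mul_right hρ' ?_) (hu2.trans hv2.symm))
    have hu' := (mem_Eset.1 hu).2
    have hv' := (mem_Eset.1 hv).2
    rw [hu2, zero_mul, add_zero] at hu'
    rw [hv2, zero_mul, add_zero] at hv'
    exact hu'.trans hv'.symm
  have h1 := weight_le_vdeg ρ' σ' hij
  rw [← (mem_Eset.1 hw).2] at h1
  have h2 := weight_le_vdeg ρ σ (mem_Eset.1 hw).1
  rw [← hd] at h2
  simp only [zero_mul, add_zero] at h1 h2
  have h3 := Nat.mul_le_mul_right ρ h1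
  have h4 := Nat.mul_le_mul_right ρ' h2
  have h5 := Nat.mul_lt_mul_of_pos_left h hb
  nlinarith

/-- Of two edges, the one with larger slope `ρ / σ` does not reach the axis `i = 0`. -/
lemma fst_pos_of_edge {F : Type*} [Field F] {α : (ℕ × ℕ) →₀ F} {ρ σ ρ' σ' : ℕ}
    (hσ : 0 < σ) (h : ρ * σ' < ρ' * σ) (he : 1 < (Eset F α ρ σ).card)
    (ij : ℕ × ℕ) (hij : ij ∈ α.support) (hd : ij.1 * ρ' + ij.2 * σ' = vdeg F α ρ' σ') :
    0 < ij.1 := by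
  obtain ⟨i, j⟩ := ij
  refine Nat.pos_of_ne_zero fun (hi : i = 0) => ?_
  subst hi
  obtain ⟨w, hw, hb⟩ : ∃ w ∈ Eset F α ρ σ, 0 < w.1 := by
    by_contra! hzero
    obtain ⟨u, hu, v, hv, huv⟩ := Finset.one_lt_card.1 he
    have hu1 : u.1 = 0 := Nat.le_zero.1 (hzero u hu)
    have hv1 : v.1 = 0 := Nat.le_zero.1 (hzero v hv)
    refine huv (Prod.ext (hu1.trans hv1.symm) (Nat.eq_of_mul_eq_mul_right hσ ?_))
    have hu' := (mem_Eset.1 hu).2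
    have hv' := (mem_Eset.1 hv).2
    rw [hu1, zero_mul, zero_add] at hu'
    rw [hv1, zero_mul, zero_add] at hv'
    exact hu'.trans hv'.symm
  have h1 := weight_le_vdeg ρ σ hij
  rw [← (mem_Eset.1 hw).2] at h1
  have h2 := weight_le_vdeg ρ' σ' (mem_Eset.1 hw).1
  rw [← hd] at h2
  simp only [zero_mul, zero_add] at h1 h2
  have h3 := Nat.mul_le_mul_right σ' h1
  have h4 := Nat.mul_le_mul_right σ h2
  have h5 := Nat.mul_lt_mul_of_pos_left h hb
  nlinarith

/-- Theorem 5.6. -/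
theorem gcd_all_exponents_gt_one (x : WeylAlgebra F) (α : (ℕ × ℕ) →₀ F)
    (hrep : Represents F α x) (hsol : Solvable F x)
    (hvall : ∀ ρ σ : ℕ, 0 < ρ → 0 < σ → Nat.Coprime ρ σ → ρ + σ ≤ vdeg F α ρ σ)
    (k : ℕ) (hk : 2 ≤ k) (ρs σs : Fin k → ℕ)
    (hρs : ∀ l, 0 < ρs l) (hσs : ∀ l, 0 < σs l)
    (hcop : ∀ l, Nat.Coprime (ρs l) (σs l))
    (hmono : ∀ l l' : Fin k, l < l' → ρs l * σs l' < ρs l' * σs l)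
    (hedge : ∀ l, 1 < (Eset F α (ρs l) (σs l)).card)
    (hall : ∀ ρ σ : ℕ, 0 < ρ → 0 < σ → Nat.Coprime ρ σ →
      1 < (Eset F α ρ σ).card → ∃ l, ρ * σs l = ρs l * σ)
    (f : Fin k → MvPolynomial (Fin 2) F) (r : Fin k → ℕ) (hr : ∀ l, 1 ≤ r l)
    (hp : ∀ l, wpoly F α (ρs l) (σs l) = f l ^ r l)
    (hnp : ∀ (l : Fin k) (κ : MvPolynomial (Fin 2) F) (m : ℕ), 1 < m → f l ≠ κ ^ m) :
    1 < Finset.univ.gcd r := by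
  exfalso
  let l : Fin k := ⟨0, by lia⟩
  let l' : Fin k := ⟨1, by lia⟩
  have hlt : ρs l * σs l' < ρs l' * σs l := hmono l l' Nat.zero_lt_one
  have hσ : σs l ≤ 1 := by
    obtain ⟨u, hu, v, hv, huv⟩ := Finset.one_lt_card.1 (hedge l)
    exact hsol.snd_weight_le_one hrep (hρs l) (hσs l) (hcop l)
      (fun ij hij => weight_le_vdeg _ _ hij) (mem_Eset.1 hu).1 (mem_Eset.1 hv).1 huv
      (mem_Eset.1 hu).2 (mem_Eset.1 hv).2 (snd_pos_of_edge (hρs l') hlt (hedge l'))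
  have hρ : ρs l' ≤ 1 := by
    obtain ⟨u, hu, v, hv, huv⟩ := Finset.one_lt_card.1 (hedge l')
    exact hsol.fst_weight_le_one hrep (hρs l') (hσs l') (hcop l')
      (fun ij hij => weight_le_vdeg _ _ hij) (mem_Eset.1 hu).1 (mem_Eset.1 hv).1 huv
      (mem_Eset.1 hu).2 (mem_Eset.1 hv).2 (fst_pos_of_edge (hσs l) hlt (hedge l))
  have h1 := Nat.mul_pos (hρs l) (hσs l')
  have h2 := Nat.mul_le_mul hρ hσ
  lia
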